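/- For two quantum states ρ₁, ρ₂ on ℂ² and α ∈ [0,1], H(ρ₁ ⊞_α ρ₂) ≥ ℓ(α ℓ⁻¹(H(ρ₁)) + (1−α) ℓ⁻¹(H(ρ₂))), where ℓ(x) := h((1+x)/2) for x ∈ [0,1], h is the binary entropy in nats, ℓ⁻¹ is the inverse of ℓ on [0,1], and ρ₁ ⊞_α ρ₂ = α ρ₁ + (1−α) ρ₂ − √(α(1−α)) i[ρ₁,ρ₂]. -/

import Mathlib

open Matrix
open scoped ComplexOrder

/-- The partial swap addition rule `ρ ⊞_α σ`. -/
noncomputable def boxplus (α : ℝ) (ρ σ : Matrix (Fin 2) (Fin 2) ℂ) :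
    Matrix (Fin 2) (Fin 2) ℂ :=
  (α : ℂ) • ρ + ((1 - α : ℝ) : ℂ) • σ
    - ((Real.sqrt (α * (1 - α)) : ℂ) * Complex.I) • (ρ * σ - σ * ρ)

open scoped Classical in
/-- The von Neumann entropy of a matrix, via its eigenvalues (natural logarithm). -/
noncomputable def vnEntropy (ρ : Matrix (Fin 2) (Fin 2) ℂ) : ℝ :=
  if h : ρ.IsHermitian then ∑ i, Real.negMulLog (h.eigenvalues i) else 0

/-- `ℓ(x) = h((1+x)/2)` where `h` is the binary entropy in nats. -/
noncomputable def ell (x : ℝ) : ℝ := Real.binEntropy ((1 + x) / 2)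

/-- The Hermitian matrix of trace one with Bloch vector `(a, b, c)`. -/
noncomputable def blochMatrix (a b c : ℝ) : Matrix (Fin 2) (Fin 2) ℂ :=
  !![(1 + c) / 2, (a - b * Complex.I) / 2; (a + b * Complex.I) / 2, (1 - c) / 2]

theorem isHermitian_blochMatrix (a b c : ℝ) : (blochMatrix a b c).IsHermitian := by
  ext i j
  fin_cases i <;> fin_cases j <;> simp [blochMatrix, Complex.ext_iff]

theorem det_blochMatrix (a b c : ℝ) :
    (blochMatrix a b c).det = ((1 - (a ^ 2 + b ^ 2 + c ^ 2)) / 4 : ℝ) := by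
  rw [blochMatrix, Matrix.det_fin_two_of]
  push_cast
  linear_combination (b ^ 2 / 4 : ℂ) * Complex.I_sq

theorem trace_blochMatrix (a b c : ℝ) : (blochMatrix a b c).trace = 1 := by
  rw [blochMatrix, Matrix.trace_fin_two_of]
  ring

theorem exists_eq_blochMatrix {ρ : Matrix (Fin 2) (Fin 2) ℂ} (hρ : ρ.IsHermitian)
    (htr : ρ.trace = 1) : ∃ a b c : ℝ, ρ = blochMatrix a b c := by
  refine ⟨2 * (ρ 0 1).re, -2 * (ρ 0 1).im, 2 * (ρ 0 0).re - 1, ?_⟩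
  have h00 := hρ.apply 0 0
  have h01 := hρ.apply 0 1
  rw [Matrix.trace_fin_two] at htr
  simp only [Complex.ext_iff, Complex.star_def, Complex.conj_re, Complex.conj_im,
    Complex.add_re, Complex.add_im, Complex.one_re, Complex.one_im] at h00 h01 htr
  ext i j
  fin_cases i <;> fin_cases j <;> simp [blochMatrix, Complex.ext_iff] <;>
    first
      | constructor <;> linarith
      | linarith

/-- The entropy of a Hermitian matrix of trace one is `ell` of the length of its Bloch vector. -/
theorem vnEntropy_blochMatrix (a b c : ℝ) :
    vnEntropy (blochMatrix a b c) = ell √(a ^ 2 + b ^ 2 + c ^ 2) := by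
  have hH := isHermitian_blochMatrix a b c
  have htr := hH.trace_eq_sum_eigenvalues
  have hdet := hH.det_eq_prod_eigenvalues
  rw [trace_blochMatrix] at htr
  rw [det_blochMatrix] at hdet
  simp only [Fin.sum_univ_two, Fin.prod_univ_two, Complex.coe_algebraMap] at htr hdet
  norm_cast at htr hdet
  rw [vnEntropy, dif_pos hH, Fin.sum_univ_two, ell,
    Real.binEntropy_eq_negMulLog_add_negMulLog_one_sub]
  set r := √(a ^ 2 + b ^ 2 + c ^ 2)
  have hr : r ^ 2 = a ^ 2 + b ^ 2 + c ^ 2 := Real.sq_sqrt (by positivity)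
  set p := hH.eigenvalues 0
  have hq : hH.eigenvalues 1 = 1 - p := by linarith
  rw [hq] at hdet ⊢
  have hroots : (p - (1 + r) / 2) * (p - (1 - r) / 2) = 0 := by
    linear_combination hdet - hr / 4
  rcases mul_eq_zero.mp hroots with h | h
  · rw [sub_eq_zero.mp h]
  · rw [sub_eq_zero.mp h, add_comm]
    ring_nf

theorem boxplus_blochMatrix (α a b c a' b' c' : ℝ) :
    boxplus α (blochMatrix a b c) (blochMatrix a' b' c') =
      blochMatrix (α * a + (1 - α) * a' + √(α * (1 - α)) * (b * c' - c * b'))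
        (α * b + (1 - α) * b' + √(α * (1 - α)) * (c * a' - a * c'))
        (α * c + (1 - α) * c' + √(α * (1 - α)) * (a * b' - b * a')) := by
  ext i j
  fin_cases i <;> fin_cases j <;>
    simp [boxplus, blochMatrix, Complex.ext_iff, -mul_eq_zero] <;>
    constructor <;> ring

theorem bloch_sq_le_one {a b c : ℝ} (h : (blochMatrix a b c).PosSemidef) :
    a ^ 2 + b ^ 2 + c ^ 2 ≤ 1 := by
  have hdet := h.det_nonneg
  rw [det_blochMatrix] at hdet
  have hreal : 0 ≤ (1 - (a ^ 2 + b ^ 2 + c ^ 2)) / 4 := by exact_mod_cast hdet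
  linarith

theorem strictAntiOn_ell : StrictAntiOn ell (Set.Icc 0 1) := fun x hx y hy hxy =>
  Real.binEntropy_strictAntiOn (by constructor <;> linarith [hx.1, hx.2])
    (by constructor <;> linarith [hy.1, hy.2]) (by linarith)

/-- The partial swap sum of two vectors of the unit ball is no longer than the convex combination
of their lengths. -/
theorem boxplus_bloch_length_le {α a b c a' b' c' r s : ℝ} (hα : α ∈ Set.Icc (0 : ℝ) 1)
    (hr : r ∈ Set.Icc (0 : ℝ) 1) (hs : s ∈ Set.Icc (0 : ℝ) 1)
    (hr2 : r ^ 2 = a ^ 2 + b ^ 2 + c ^ 2) (hs2 : s ^ 2 = a' ^ 2 + b' ^ 2 + c' ^ 2) :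
    √((α * a + (1 - α) * a' + √(α * (1 - α)) * (b * c' - c * b')) ^ 2 +
        (α * b + (1 - α) * b' + √(α * (1 - α)) * (c * a' - a * c')) ^ 2 +
        (α * c + (1 - α) * c' + √(α * (1 - α)) * (a * b' - b * a')) ^ 2) ≤
      α * r + (1 - α) * s := by
  obtain ⟨hα0, hα1⟩ := hα
  obtain ⟨hr0, hr1⟩ := hr
  obtain ⟨hs0, hs1⟩ := hs
  have hα' : 0 ≤ 1 - α := by linarith
  have ht : √(α * (1 - α)) ^ 2 = α * (1 - α) := Real.sq_sqrt (by positivity)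
  set t := √(α * (1 - α))
  set d := a * a' + b * b' + c * c' with hd
  have hcross : (b * c' - c * b') ^ 2 + (c * a' - a * c') ^ 2 + (a * b' - b * a') ^ 2
      = (r * s) ^ 2 - d ^ 2 := by
    rw [mul_pow, hr2, hs2]
    ring
  have hdle : d ≤ r * s := by
    refine le_of_sq_le_sq ?_ (by positivity)
    linarith [sq_nonneg (b * c' - c * b'), sq_nonneg (c * a' - a * c'),
      sq_nonneg (a * b' - b * a')]
  have hrs : r * s ≤ 1 := mul_le_one₀ hr1 hs0 hs1
  have hkey : 0 ≤ α * (1 - α) * ((r * s - d) * (2 - r * s - d)) :=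
    mul_nonneg (mul_nonneg hα0 hα') (mul_nonneg (by linarith) (by linarith))
  refine Real.sqrt_le_iff.mpr ⟨by positivity, ?_⟩
  have hnorm : (α * a + (1 - α) * a' + t * (b * c' - c * b')) ^ 2 +
        (α * b + (1 - α) * b' + t * (c * a' - a * c')) ^ 2 +
        (α * c + (1 - α) * c' + t * (a * b' - b * a')) ^ 2 =
      α ^ 2 * r ^ 2 + (1 - α) ^ 2 * s ^ 2 + 2 * α * (1 - α) * d +
        α * (1 - α) * ((r * s) ^ 2 - d ^ 2) := by
    rw [← hcross, ← ht, hr2, hs2, hd]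
    ring
  rw [hnorm]
  linarith

theorem stmt_19 (α : ℝ) (hα : α ∈ Set.Icc (0:ℝ) 1)
    (ρ₁ ρ₂ : Matrix (Fin 2) (Fin 2) ℂ)
    (hρ₁ : ρ₁.PosSemidef) (hρ₁tr : ρ₁.trace = 1)
    (hρ₂ : ρ₂.PosSemidef) (hρ₂tr : ρ₂.trace = 1)
    -- `r₁ = ℓ⁻¹(H(ρ₁))` and `r₂ = ℓ⁻¹(H(ρ₂))`
    (r₁ r₂ : ℝ) (hr₁ : r₁ ∈ Set.Icc (0:ℝ) 1) (hr₂ : r₂ ∈ Set.Icc (0:ℝ) 1)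
    (hℓ₁ : ell r₁ = vnEntropy ρ₁) (hℓ₂ : ell r₂ = vnEntropy ρ₂) :
    vnEntropy (boxplus α ρ₁ ρ₂) ≥ ell (α * r₁ + (1 - α) * r₂) := by
  obtain ⟨a, b, c, rfl⟩ := exists_eq_blochMatrix hρ₁.isHermitian hρ₁tr
  obtain ⟨a', b', c', rfl⟩ := exists_eq_blochMatrix hρ₂.isHermitian hρ₂tr
  have hlen {x y z r : ℝ} (hρ : (blochMatrix x y z).PosSemidef) (hr : r ∈ Set.Icc (0 : ℝ) 1)
      (hℓ : ell r = vnEntropy (blochMatrix x y z)) : r ^ 2 = x ^ 2 + y ^ 2 + z ^ 2 := by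
    rw [vnEntropy_blochMatrix] at hℓ
    rw [strictAntiOn_ell.injOn hr
      ⟨Real.sqrt_nonneg _, Real.sqrt_le_one.mpr (bloch_sq_le_one hρ)⟩ hℓ]
    exact Real.sq_sqrt (by positivity)
  have hle := boxplus_bloch_length_le hα hr₁ hr₂ (hlen hρ₁ hr₁ hℓ₁) (hlen hρ₂ hr₂ hℓ₂)
  have hα' : 0 ≤ 1 - α := sub_nonneg.mpr hα.2
  have hconv : α * r₁ + (1 - α) * r₂ ≤ 1 := by
    nlinarith [mul_le_mul_of_nonneg_left hr₁.2 hα.1, mul_le_mul_of_nonneg_left hr₂.2 hα']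
  rw [boxplus_blochMatrix, vnEntropy_blochMatrix]
  exact strictAntiOn_ell.antitoneOn ⟨Real.sqrt_nonneg _, hle.trans hconv⟩
    ⟨(Real.sqrt_nonneg _).trans hle, hconv⟩ hle
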